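/- Let d ≥ 2, m ≥ 2, let Ω be the jittered partition of [0,1]^d into m^d axis-aligned cubes of side 1/m, and let Ω̃ be any partition of [0,1]^d into m^d sets that coincides with Ω outside the rectangle I = [1−2/m, 1] × [1−1/m, 1]^{d−1} and whose two sets inside I are the prisms Ω_{1,\} and Ω_{2,\} of the prism partition Ω_\ of I (prisms over the two triangles obtained by cutting the base rectangle [1−2/m,1]×[1−1/m,1] along the diagonal from (1,1−1/m) to (1−2/m,1)). Denoting by Ω_| the partition of I into its two constituent jittered cubes, one has m^{2d} · [E L2²(P_Ω) − E L2²(P_Ω̃)] = 4·|I|·[E L2²(P_{Ω_|}) − E L2²(P_{Ω_\})], where E L2²(P_{Ω_|}) and E L2²(P_{Ω_\}) are the mean squared L2-discrepancies of the two-point stratified samples in the compact convex set K = I, and |I| = 2·m^{−d}. -/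

import Mathlib

open MeasureTheory ProbabilityTheory

noncomputable section

namespace StratifiedSampling

variable {d : ℕ} {ι : Type} [Fintype ι]

/-- Lebesgue volume of a subset of `ℝ^d` as a real number. -/
def vol (s : Set (Fin d → ℝ)) : ℝ := (volume s).toReal

/-- Number of points of the configuration `p` that lie in the lower box `(-∞, x]`. -/
def countIn (p : ι → (Fin d → ℝ)) (x : Fin d → ℝ) : ℝ :=
  ∑ i, Set.indicator (Set.Iic x) (fun _ => (1 : ℝ)) (p i)

/-- Discrepancy function of the point configuration `p` in the set `K`:
`d_P(x) = #(P ∩ (-∞,x])/N − |K ∩ (-∞,x]|/|K|`. -/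
def discrep (K : Set (Fin d → ℝ)) (p : ι → (Fin d → ℝ)) (x : Fin d → ℝ) : ℝ :=
  countIn p x / (Fintype.card ι : ℝ) - vol (K ∩ Set.Iic x) / vol K

/-- Joint distribution of the stratified sample associated with the family `Ω`:
the points are independent and the `i`-th point is uniformly distributed on `Ω i`. -/
def stratDist (Ω : ι → Set (Fin d → ℝ)) : Measure (ι → (Fin d → ℝ)) :=
  Measure.pi fun i => ProbabilityTheory.cond volume (Ω i)

/-- Mean squared `L2`-discrepancy of the stratified sample from the family `Ω` in `K`:
`E L2²(P_Ω) = E[(1/|K|) ∫_K d_{P_Ω}(x)² dx]`. -/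
def meanL2sq (K : Set (Fin d → ℝ)) (Ω : ι → Set (Fin d → ℝ)) : ℝ :=
  ∫ p, ((1 / vol K) * ∫ x in K, (discrep K p x) ^ 2) ∂(stratDist Ω)

/-- `Ω` is a partition of `K`: measurable sets of positive volume whose union
is `K` and whose distinct members have disjoint interiors. -/
structure IsPartition (K : Set (Fin d → ℝ)) (Ω : ι → Set (Fin d → ℝ)) : Prop where
  measurableSet : ∀ i, MeasurableSet (Ω i)
  vol_pos : ∀ i, 0 < volume (Ω i)
  iUnion_eq : (⋃ i, Ω i) = K
  disjoint_interiors : ∀ i j, i ≠ j → interior (Ω i) ∩ interior (Ω j) = ∅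

/-- All members of `Ω` have the same volume. -/
def IsEquivolume (Ω : ι → Set (Fin d → ℝ)) : Prop :=
  ∀ i j, volume (Ω i) = volume (Ω j)

/-- `q_i(x) = |Ω_i ∩ (-∞,x]| / |Ω_i|`. -/
def qfun (Ω : ι → Set (Fin d → ℝ)) (i : ι) (x : Fin d → ℝ) : ℝ :=
  vol (Ω i ∩ Set.Iic x) / vol (Ω i)

end StratifiedSampling

namespace StratifiedSampling

/-- The jittered cube with multi-index `j`: `∏_k [j_k/m, (j_k+1)/m]`. -/
def jitteredCube {d : ℕ} (m : ℕ) (j : Fin d → Fin m) : Set (Fin d → ℝ) :=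
  Set.Icc (fun k => (j k : ℝ) / m) (fun k => ((j k : ℝ) + 1) / m)

/-- The rectangle `I = [1−2/m, 1] × [1−1/m, 1]^{d−1}`. -/
def cornerBox (d m : ℕ) : Set (Fin d → ℝ) :=
  Set.Icc (fun k => if (k : ℕ) = 0 then 1 - 2 / (m : ℝ) else 1 - 1 / (m : ℝ)) 1

/-- The lower triangular prism: prism over the triangle
`conv{(1−2/m, 1−1/m), (1, 1−1/m), (1−2/m, 1)}` times `∏_{i=3}^d [1−1/m, 1]`. -/
def prismA (d m : ℕ) (hd : 2 ≤ d) : Set (Fin d → ℝ) :=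
  {x | ![x ⟨0, by omega⟩, x ⟨1, by omega⟩] ∈
      convexHull ℝ {![1 - 2 / (m : ℝ), 1 - 1 / (m : ℝ)], ![1, 1 - 1 / (m : ℝ)],
        ![1 - 2 / (m : ℝ), 1]} ∧
    ∀ k : Fin d, 2 ≤ (k : ℕ) → (1 - 1 / (m : ℝ) ≤ x k ∧ x k ≤ 1)}

/-- The complementary triangular prism in `I`: prism over the triangle
`conv{(1, 1−1/m), (1−2/m, 1), (1, 1)}` times `∏_{i=3}^d [1−1/m, 1]`. -/
def prismB (d m : ℕ) (hd : 2 ≤ d) : Set (Fin d → ℝ) :=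
  {x | ![x ⟨0, by omega⟩, x ⟨1, by omega⟩] ∈
      convexHull ℝ {![1, 1 - 1 / (m : ℝ)], ![1 - 2 / (m : ℝ), 1], ![(1 : ℝ), 1]} ∧
    ∀ k : Fin d, 2 ≤ (k : ℕ) → (1 - 1 / (m : ℝ) ≤ x k ∧ x k ≤ 1)}

/-- Multi-index of the jittered cube `[1−2/m, 1−1/m] × [1−1/m, 1]^{d−1}`. -/
def idxA (d m : ℕ) (hm : 2 ≤ m) : Fin d → Fin m :=
  fun k => if (k : ℕ) = 0 then ⟨m - 2, by omega⟩ else ⟨m - 1, by omega⟩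

/-- Multi-index of the jittered cube `[1−1/m, 1]^d`. -/
def idxB (d m : ℕ) (hm : 2 ≤ m) : Fin d → Fin m :=
  fun _ => ⟨m - 1, by omega⟩

section General

variable {d : ℕ} {ι : Type} [Fintype ι]

/-- Sum over the family `Ω` of the variances `q_i(x) (1 - q_i(x))` of the indicators of
`X_i ∈ (-∞, x]`. -/
def sumVar (Ω : ι → Set (Fin d → ℝ)) (x : Fin d → ℝ) : ℝ :=
  ∑ i, qfun Ω i x * (1 - qfun Ω i x)

variable {K : Set (Fin d → ℝ)} {Ω : ι → Set (Fin d → ℝ)}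

lemma measurable_vol_inter_Iic (hK : MeasurableSet K) :
    Measurable fun x => vol (K ∩ Set.Iic x) := by
  have h : MeasurableSet {z : (Fin d → ℝ) × (Fin d → ℝ) | z.2 ∈ K ∧ z.2 ≤ z.1} :=
    (measurable_snd hK).inter (measurableSet_le measurable_snd measurable_fst)
  exact (measurable_measure_prodMk_left (ν := volume) h).ennreal_toReal

lemma vol_inter_div_nonneg (x : Fin d → ℝ) : 0 ≤ vol (K ∩ Set.Iic x) / vol K :=
  div_nonneg ENNReal.toReal_nonneg ENNReal.toReal_nonneg

lemma vol_inter_div_le_one (hKf : volume K ≠ ⊤) (x : Fin d → ℝ) :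
    vol (K ∩ Set.Iic x) / vol K ≤ 1 :=
  div_le_one_of_le₀ (ENNReal.toReal_mono hKf (measure_mono Set.inter_subset_left))
    ENNReal.toReal_nonneg

lemma measurable_discrep (hK : MeasurableSet K) :
    Measurable fun z : (ι → (Fin d → ℝ)) × (Fin d → ℝ) => discrep K z.1 z.2 := by
  unfold discrep countIn
  refine Measurable.sub (Measurable.div_const (Finset.measurable_sum _ fun i _ => ?_) _)
    (((measurable_vol_inter_Iic hK).comp measurable_snd).div_const _)
  have h : MeasurableSet {z : (ι → (Fin d → ℝ)) × (Fin d → ℝ) | z.1 i ≤ z.2} :=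
    measurableSet_le ((measurable_pi_apply i).comp measurable_fst) measurable_snd
  exact (measurable_const (a := (1 : ℝ))).indicator h

lemma abs_discrep_le_one (hKf : volume K ≠ ⊤) (p : ι → (Fin d → ℝ)) (x : Fin d → ℝ) :
    |discrep K p x| ≤ 1 := by
  have h0 : 0 ≤ countIn p x :=
    Finset.sum_nonneg fun i _ => Set.indicator_nonneg (fun _ _ => zero_le_one) _
  have h1 : countIn p x ≤ Fintype.card ι := by
    calc countIn p x ≤ ∑ _i : ι, (1 : ℝ) :=
          Finset.sum_le_sum fun i _ => Set.indicator_le_self' (fun _ _ => zero_le_one) _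
      _ = Fintype.card ι := by simp
  have h2 : 0 ≤ countIn p x / (Fintype.card ι : ℝ) := by positivity
  have h3 : countIn p x / (Fintype.card ι : ℝ) ≤ 1 := div_le_one_of_le₀ h1 (by positivity)
  have h4 := vol_inter_div_nonneg (K := K) x
  have h5 := vol_inter_div_le_one hKf x
  rw [abs_le]
  unfold discrep
  constructor <;> linarith

lemma isProbabilityMeasure_cond_of_vol_pos {s : Set (Fin d → ℝ)} (hs : 0 < vol s) :
    IsProbabilityMeasure (ProbabilityTheory.cond volume s) := by
  obtain ⟨h0, h1⟩ := ENNReal.toReal_pos_iff.1 hs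
  exact cond_isProbabilityMeasure_of_finite h0.ne' h1.ne

lemma cond_real_Iic {κ : Type*} {Θ : κ → Set (Fin d → ℝ)} (hΘ : ∀ i, MeasurableSet (Θ i)) (i : κ)
    (x : Fin d → ℝ) :
    (ProbabilityTheory.cond volume (Θ i)).real (Set.Iic x) =
      vol (Θ i ∩ Set.Iic x) / vol (Θ i) := by
  rw [Measure.real, cond_apply (hΘ i), ENNReal.toReal_mul, ENNReal.toReal_inv, vol, vol]
  ring

lemma variance_indicator_one {α : Type*} [MeasurableSpace α] (μ : Measure α)
    [IsProbabilityMeasure μ] {s : Set α} (hs : MeasurableSet s) :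
    variance (s.indicator fun _ => (1 : ℝ)) μ = μ.real s * (1 - μ.real s) := by
  have hsq : (s.indicator fun _ => (1 : ℝ)) ^ 2 = s.indicator fun _ => (1 : ℝ) := by
    ext a
    by_cases ha : a ∈ s <;> simp [ha]
  rw [variance_eq_sub (memLp_indicator_const 2 hs 1 (Or.inr (measure_ne_top _ _))), hsq,
    integral_indicator_const _ hs]
  simp only [smul_eq_mul]
  ring

lemma integral_sq_discrep (hΩ : ∀ i, MeasurableSet (Ω i)) (hpos : ∀ i, 0 < vol (Ω i))
    {x : Fin d → ℝ}
    (hmean : (∑ i, qfun Ω i x) / Fintype.card ι = vol (K ∩ Set.Iic x) / vol K) :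
    ∫ p, (discrep K p x) ^ 2 ∂(stratDist Ω) = sumVar Ω x / (Fintype.card ι : ℝ) ^ 2 := by
  have hprob : ∀ i, IsProbabilityMeasure (ProbabilityTheory.cond volume (Ω i)) :=
    fun i => isProbabilityMeasure_cond_of_vol_pos (hpos i)
  set X : ι → (Fin d → ℝ) → ℝ := fun _ => (Set.Iic x).indicator fun _ => (1 : ℝ) with hX
  have hmem : ∀ i, MemLp (X i) 2 (ProbabilityTheory.cond volume (Ω i)) := fun i =>
    memLp_indicator_const 2 measurableSet_Iic 1 (Or.inr (measure_ne_top _ _))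
  have hvar := variance_sum_pi hmem
  have hsum : (∑ i, fun p : ι → (Fin d → ℝ) => X i (p i)) = fun p => countIn p x := by
    ext p
    simp [countIn, hX, Finset.sum_apply]
  have hexp : ∫ p, countIn p x ∂(stratDist Ω) = ∑ i, qfun Ω i x := by
    unfold countIn stratDist
    rw [integral_finsetSum]
    · refine Finset.sum_congr rfl fun i _ => ?_
      rw [qfun, ← cond_real_Iic hΩ i x]
      have := integral_comp_eval (μ := fun i => ProbabilityTheory.cond volume (Ω i)) (i := i)
        (hmem i).aestronglyMeasurable
      rw [this, hX, integral_indicator_const _ measurableSet_Iic]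
      simp
    · intro i _
      exact integrable_comp_eval (μ := fun i => ProbabilityTheory.cond volume (Ω i)) (i := i)
        ((hmem i).integrable (by norm_num))
  have hmeas : Measurable fun p : ι → (Fin d → ℝ) => countIn p x := by
    unfold countIn
    refine Finset.measurable_sum _ fun i _ => ?_
    exact (measurable_const.indicator measurableSet_Iic).comp (measurable_pi_apply i)
  rw [hsum, variance_eq_integral hmeas.aemeasurable] at hvar
  have hrw : ∀ p : ι → (Fin d → ℝ), discrep K p x ^ 2 =
      (countIn p x - ∑ i, qfun Ω i x) ^ 2 / (Fintype.card ι : ℝ) ^ 2 := by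
    intro p
    rw [discrep, ← hmean, ← sub_div, div_pow]
  simp only [hrw]
  rw [integral_div]
  congr 1
  unfold stratDist at hexp ⊢
  rw [hexp] at hvar
  rw [hvar, sumVar]
  refine Finset.sum_congr rfl fun i _ => ?_
  rw [qfun, ← cond_real_Iic hΩ i x]
  exact variance_indicator_one _ measurableSet_Iic

/-- The expected squared discrepancy of an equivolume stratified sample is, up to normalization,
the integral of the sum of the variances of the indicators. -/
lemma meanL2sq_eq (hK : MeasurableSet K) (hKf : volume K ≠ ⊤)
    (hΩ : ∀ i, MeasurableSet (Ω i)) (hpos : ∀ i, 0 < vol (Ω i))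
    (hmean : ∀ x, (∑ i, qfun Ω i x) / Fintype.card ι = vol (K ∩ Set.Iic x) / vol K) :
    meanL2sq K Ω = (∫ x in K, sumVar Ω x) / (vol K * (Fintype.card ι : ℝ) ^ 2) := by
  have hprob : ∀ i, IsProbabilityMeasure (ProbabilityTheory.cond volume (Ω i)) :=
    fun i => isProbabilityMeasure_cond_of_vol_pos (hpos i)
  have : IsProbabilityMeasure (stratDist Ω) := by unfold stratDist; infer_instance
  have : IsFiniteMeasure (volume.restrict K) := isFiniteMeasure_restrict.2 hKf
  have hint : Integrable (Function.uncurry fun p x => (discrep K p x) ^ 2)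
      ((stratDist Ω).prod (volume.restrict K)) := by
    refine Integrable.of_bound ((measurable_discrep hK).pow_const 2).aestronglyMeasurable 1
      (Filter.Eventually.of_forall fun z => ?_)
    simp only [Function.uncurry, Real.norm_eq_abs, abs_pow]
    exact pow_le_one₀ (abs_nonneg _) (abs_discrep_le_one hKf _ _)
  unfold meanL2sq
  rw [integral_const_mul, integral_integral_swap hint]
  simp only [integral_sq_discrep hΩ hpos (hmean _)]
  rw [integral_div]
  field_simp

lemma integrableOn_sumVar (hKf : volume K ≠ ⊤)
    (hΩ : ∀ i, MeasurableSet (Ω i)) (hf : ∀ i, volume (Ω i) ≠ ⊤) :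
    IntegrableOn (sumVar Ω) K := by
  have : IsFiniteMeasure (volume.restrict K) := isFiniteMeasure_restrict.2 hKf
  unfold sumVar
  refine integrable_finsetSum _ fun i _ => ?_
  have hq : Measurable (qfun Ω i) := (measurable_vol_inter_Iic (hΩ i)).div_const _
  refine Integrable.of_bound (hq.mul (hq.const_sub 1)).aestronglyMeasurable 1
    (Filter.Eventually.of_forall fun x => ?_)
  have h0 : 0 ≤ qfun Ω i x := vol_inter_div_nonneg x
  have h1 : qfun Ω i x ≤ 1 := vol_inter_div_le_one (hf i) x
  rw [Real.norm_eq_abs, abs_le]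
  constructor <;> nlinarith

end General

section Partition

variable {d : ℕ} {ι : Type} [Fintype ι] {K : Set (Fin d → ℝ)} {Ω : ι → Set (Fin d → ℝ)}

lemma sum_vol_inter_eq (hΩ : ∀ i, MeasurableSet (Ω i))
    (hdisj : Pairwise fun i j => volume (Ω i ∩ Ω j) = 0) (hU : ⋃ i, Ω i = K)
    (hKf : volume K ≠ ⊤) {S : Set (Fin d → ℝ)} (hS : MeasurableSet S) :
    ∑ i, vol (Ω i ∩ S) = vol (K ∩ S) := by
  have h := measureReal_biUnion_finset₀ (μ := volume) (s := Finset.univ)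
    (f := fun i => Ω i ∩ S)
    (fun i _ j _ hij => measure_mono_null
      (Set.inter_subset_inter Set.inter_subset_left Set.inter_subset_left) (hdisj hij))
    (fun i _ => ((hΩ i).inter hS).nullMeasurableSet)
    (fun i _ => measure_ne_top_of_subset
      (Set.inter_subset_left.trans (hU ▸ Set.subset_iUnion Ω i)) hKf)
  simp only [Finset.mem_univ, Set.iUnion_true, ← Set.iUnion_inter, hU] at h
  exact h.symm

lemma vol_inter_add_vol_inter {A B : Set (Fin d → ℝ)} (hA : MeasurableSet A)
    (hB : MeasurableSet B) (hAB : volume (A ∩ B) = 0) (hU : A ∪ B = K)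
    (hKf : volume K ≠ ⊤) {S : Set (Fin d → ℝ)} (hS : MeasurableSet S) :
    vol (A ∩ S) + vol (B ∩ S) = vol (K ∩ S) := by
  have h := sum_vol_inter_eq (Ω := fun b : Bool => cond b A B) (K := K)
    (by simp [hA, hB])
    (by
      intro i j hij
      cases i <;> cases j <;> simp_all [Set.inter_comm])
    (by rw [← hU, Set.union_eq_iUnion]) hKf hS
  simpa using h

lemma sum_qfun_div_card {c : ℝ} (hc : ∀ i, vol (Ω i) = c)
    (hcK : vol K = Fintype.card ι * c) {x : Fin d → ℝ}
    (hsum : ∑ i, vol (Ω i ∩ Set.Iic x) = vol (K ∩ Set.Iic x)) :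
    (∑ i, qfun Ω i x) / Fintype.card ι = vol (K ∩ Set.Iic x) / vol K := by
  simp only [qfun, hc]
  rw [← Finset.sum_div, hsum, hcK, div_div, mul_comm]

end Partition

section Geometry

variable {d : ℕ}

lemma qfun_eq_zero_of_subset_Icc {κ : Type} {Θ : κ → Set (Fin d → ℝ)}
    {a b : Fin d → ℝ} {i : κ} (hi : Θ i ⊆ Set.Icc a b)
    {x : Fin d → ℝ} (hxb : x ≤ b) (hx : x ∉ Set.Icc a b) : qfun Θ i x = 0 := by
  have : Θ i ∩ Set.Iic x = ∅ := by
    ext y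
    simp only [Set.mem_inter_iff, Set.mem_Iic, Set.mem_empty_iff_false, iff_false, not_and]
    intro hy hyx
    exact hx ⟨(hi hy).1.trans hyx, hxb⟩
  simp [qfun, this, vol]

lemma volume_linear_level_set {L : (Fin d → ℝ) →ₗ[ℝ] ℝ} (hL : L ≠ 0) (c : ℝ) :
    volume {x | L x = c} = 0 := by
  obtain ⟨v, hv⟩ : ∃ v, L v = c := LinearMap.surjective hL c
  have h := Measure.addHaar_affineSubspace (volume : Measure (Fin d → ℝ))
    (AffineSubspace.mk' v (LinearMap.ker L)) (by
      intro h
      have := congrArg AffineSubspace.direction h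
      rw [AffineSubspace.direction_mk', AffineSubspace.direction_top] at this
      exact hL (LinearMap.ker_eq_top.1 this))
  refine measure_mono_null (fun x hx => ?_) h
  simp only [Set.mem_ofPred_eq] at hx
  simp [AffineSubspace.mem_mk', hx, hv]

lemma volume_coord_level_set (k : Fin d) (c : ℝ) :
    volume {x : Fin d → ℝ | x k = c} = 0 := by
  refine volume_linear_level_set (L := LinearMap.proj k) (fun h => ?_) c
  have := LinearMap.congr_fun h 1
  simp at this

lemma measurableSet_jitteredCube (m : ℕ) (j : Fin d → Fin m) :
    MeasurableSet (jitteredCube m j) := measurableSet_Icc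

lemma vol_jitteredCube (m : ℕ) (j : Fin d → Fin m) :
    vol (jitteredCube m j) = 1 / (m : ℝ) ^ d := by
  unfold vol jitteredCube
  rw [Real.volume_Icc_pi_toReal]
  · have : ∀ k : Fin d, ((j k : ℝ) + 1) / m - (j k : ℝ) / m = 1 / m := fun k => by ring
    simp [this]
  · intro k
    simp only
    gcongr
    linarith

lemma volume_jitteredCube_inter {m : ℕ} {i j : Fin d → Fin m} (hij : i ≠ j) :
    volume (jitteredCube m i ∩ jitteredCube m j) = 0 := by
  have key : ∀ {i j : Fin d → Fin m} {k : Fin d}, i k < j k →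
      volume (jitteredCube m i ∩ jitteredCube m j) = 0 := by
    intro i j k hk
    refine measure_mono_null (fun x hx => ?_) (volume_coord_level_set k ((j k : ℝ) / m))
    refine le_antisymm ((hx.1.2 k).trans ?_) (hx.2.1 k)
    have : ((i k : ℕ) : ℝ) + 1 ≤ (j k : ℕ) := by exact_mod_cast hk
    simp only
    gcongr
  obtain ⟨k, hk⟩ := Function.ne_iff.1 hij
  rcases lt_or_gt_of_ne hk with h | h
  · exact key h
  · rw [Set.inter_comm]
    exact key h

lemma iUnion_jitteredCube {m : ℕ} (hm : 0 < m) :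
    ⋃ j : Fin d → Fin m, jitteredCube m j = Set.Icc (0 : Fin d → ℝ) 1 := by
  have hm' : (0 : ℝ) < m := by exact_mod_cast hm
  ext x
  simp only [Set.mem_iUnion]
  constructor
  · rintro ⟨j, hj⟩
    refine ⟨fun k => le_trans (by simp only [Pi.zero_apply]; positivity) (hj.1 k),
      fun k => (hj.2 k).trans ?_⟩
    have : ((j k : ℕ) : ℝ) + 1 ≤ m := by exact_mod_cast (j k).2
    simp only [Pi.one_apply]
    exact div_le_one_of_le₀ this hm'.le
  · intro hx
    refine ⟨fun k => ⟨min ⌊(m : ℝ) * x k⌋₊ (m - 1), by omega⟩, fun k => ?_, fun k => ?_⟩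
    · have h0 : 0 ≤ x k := hx.1 k
      have h1 : ((min ⌊(m : ℝ) * x k⌋₊ (m - 1) : ℕ) : ℝ) ≤ m * x k :=
        (Nat.cast_le.2 (min_le_left _ _)).trans (Nat.floor_le (by positivity))
      simp only
      rw [div_le_iff₀ hm']
      linarith
    · have h1 : x k ≤ 1 := hx.2 k
      simp only
      rw [le_div_iff₀ hm']
      rcases min_cases ⌊(m : ℝ) * x k⌋₊ (m - 1) with ⟨h, -⟩ | ⟨h, -⟩ <;> rw [h]
      · have := Nat.lt_floor_add_one ((m : ℝ) * x k)
        linarith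
      · rw [Nat.cast_sub (by omega)]
        push_cast
        nlinarith

lemma measurableSet_cornerBox (d m : ℕ) : MeasurableSet (cornerBox d m) := measurableSet_Icc

lemma volume_cornerBox_ne_top (d m : ℕ) : volume (cornerBox d m) ≠ ⊤ :=
  isCompact_Icc.measure_lt_top.ne

lemma mem_cornerBox_iff {m : ℕ} (hd : 2 ≤ d) {x : Fin d → ℝ} :
    x ∈ cornerBox d m ↔
      (1 - 2 / (m : ℝ) ≤ x ⟨0, by omega⟩ ∧ x ⟨0, by omega⟩ ≤ 1) ∧
      (1 - 1 / (m : ℝ) ≤ x ⟨1, by omega⟩ ∧ x ⟨1, by omega⟩ ≤ 1) ∧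
      ∀ k : Fin d, 2 ≤ (k : ℕ) → (1 - 1 / (m : ℝ) ≤ x k ∧ x k ≤ 1) := by
  constructor
  · intro h
    refine ⟨⟨by simpa using h.1 ⟨0, by omega⟩, h.2 _⟩,
      ⟨by simpa using h.1 ⟨1, by omega⟩, h.2 _⟩, fun k hk => ⟨?_, h.2 k⟩⟩
    have := h.1 k
    simp only at this
    rwa [if_neg (by omega)] at this
  · rintro ⟨h0, h1, h2⟩
    have key : ∀ k : Fin d,
        (if (k : ℕ) = 0 then 1 - 2 / (m : ℝ) else 1 - 1 / (m : ℝ)) ≤ x k ∧ x k ≤ 1 := by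
      rintro ⟨k, hk⟩
      rcases k with _ | _ | k
      · simpa using h0
      · simpa using h1
      · have := h2 ⟨k + 2, hk⟩ (by simp)
        simpa using this
    exact ⟨fun k => (key k).1, fun k => (key k).2⟩

lemma jitteredCube_idxA_eq {m : ℕ} (hm : 2 ≤ m) :
    jitteredCube m (idxA d m hm) =
      Set.Icc (fun k : Fin d => if (k : ℕ) = 0 then 1 - 2 / (m : ℝ) else 1 - 1 / (m : ℝ))
        (fun k => if (k : ℕ) = 0 then 1 - 1 / (m : ℝ) else 1) := by
  have hm' : (m : ℝ) ≠ 0 := by positivity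
  unfold jitteredCube idxA
  congr 1 <;> ext k <;> split_ifs <;> simp only [] <;>
    rw [Nat.cast_sub (by omega)] <;> push_cast <;> field_simp <;> ring

lemma jitteredCube_idxB_eq {m : ℕ} (hm : 2 ≤ m) :
    jitteredCube m (idxB d m hm) = Set.Icc (fun _ : Fin d => 1 - 1 / (m : ℝ)) (fun _ => 1) := by
  have hm' : (m : ℝ) ≠ 0 := by positivity
  unfold jitteredCube idxB
  congr 1 <;> ext k <;> simp only [] <;>
    (rw [Nat.cast_sub (by omega)]; push_cast; field_simp)
  ring

lemma jitteredCube_idxA_union_idxB {m : ℕ} (hm : 2 ≤ m) (hd : 2 ≤ d) :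
    jitteredCube m (idxA d m hm) ∪ jitteredCube m (idxB d m hm) = cornerBox d m := by
  have hle : 1 / (m : ℝ) ≤ 2 / m := by gcongr; norm_num
  have hpos : 0 ≤ 1 / (m : ℝ) := by positivity
  rw [jitteredCube_idxA_eq, jitteredCube_idxB_eq]
  ext x
  simp only [Set.mem_union, cornerBox, Set.mem_Icc, Pi.le_def, Pi.one_apply]
  constructor
  · rintro (⟨h1, h2⟩ | ⟨h1, h2⟩)
    · refine ⟨h1, fun k => (h2 k).trans ?_⟩
      split_ifs <;> linarith
    · refine ⟨fun k => le_trans ?_ (h1 k), h2⟩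
      split_ifs <;> linarith
  · rintro ⟨h1, h2⟩
    rcases le_total (x ⟨0, by omega⟩) (1 - 1 / (m : ℝ)) with h | h
    · refine Or.inl ⟨h1, fun k => ?_⟩
      split_ifs with hk
      · have : k = ⟨0, by omega⟩ := Fin.ext hk
        rwa [this]
      · exact h2 k
    · refine Or.inr ⟨fun k => ?_, h2⟩
      by_cases hk : (k : ℕ) = 0
      · have : k = ⟨0, by omega⟩ := Fin.ext hk
        rwa [this]
      · have := h1 k
        rwa [if_neg hk] at this

lemma idxA_ne_idxB {m : ℕ} (hm : 2 ≤ m) (hd : 2 ≤ d) : idxA d m hm ≠ idxB d m hm := by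
  intro h
  have := congrArg Fin.val (congrFun h ⟨0, by omega⟩)
  simp [idxA, idxB] at this
  omega

lemma mem_convexHull_right_triangle {a b c e : ℝ} (hac : c - a ≠ 0) (hbe : e - b ≠ 0)
    (u v : ℝ) :
    ![u, v] ∈ convexHull ℝ {![a, b], ![c, b], ![a, e]} ↔
      0 ≤ (u - a) / (c - a) ∧ 0 ≤ (v - b) / (e - b) ∧
        (u - a) / (c - a) + (v - b) / (e - b) ≤ 1 := by
  constructor
  · intro h
    have hconv : Convex ℝ {y : Fin 2 → ℝ | 0 ≤ (y 0 - a) / (c - a) ∧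
        0 ≤ (y 1 - b) / (e - b) ∧ (y 0 - a) / (c - a) + (y 1 - b) / (e - b) ≤ 1} := by
      rintro y ⟨hy0, hy1, hy2⟩ z ⟨hz0, hz1, hz2⟩ s t hs ht hst
      have h0 : (s * y 0 + t * z 0 - a) / (c - a) =
          s * ((y 0 - a) / (c - a)) + t * ((z 0 - a) / (c - a)) := by
        field_simp
        linear_combination a * hst
      have h1 : (s * y 1 + t * z 1 - b) / (e - b) =
          s * ((y 1 - b) / (e - b)) + t * ((z 1 - b) / (e - b)) := by
        field_simp
        linear_combination b * hst
      simp only [Set.mem_ofPred_eq, Pi.add_apply, Pi.smul_apply, smul_eq_mul]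
      rw [h0, h1]
      refine ⟨by positivity, by positivity, ?_⟩
      nlinarith
    have hsub := convexHull_min (s := {![a, b], ![c, b], ![a, e]}) (by
      rintro y (rfl | rfl | rfl) <;> simp [hac, hbe]) hconv
    simpa using hsub h
  · rintro ⟨h0, h1, h2⟩
    set s := (u - a) / (c - a) with hs
    set t := (v - b) / (e - b) with ht
    have hu : u = a + s * (c - a) := by rw [hs]; field_simp; ring
    have hv : v = b + t * (e - b) := by rw [ht]; field_simp; ring
    have hmem := (convex_convexHull ℝ {![a, b], ![c, b], ![a, e]}).sum_mem
      (t := Finset.univ) (w := ![1 - s - t, s, t]) (z := ![![a, b], ![c, b], ![a, e]])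
      (by
        intro i _
        fin_cases i
        · simp
          linarith
        · simpa using h0
        · simpa using h1)
      (by
        simp [Fin.sum_univ_three]
        ring)
      (by
        intro i _
        apply subset_convexHull
        fin_cases i <;> simp)
    convert hmem using 1
    ext i
    fin_cases i
    · simp [Fin.sum_univ_three]
      linarith
    · simp [Fin.sum_univ_three]
      linarith

lemma mem_prismA_iff {m : ℕ} (hm : 2 ≤ m) (hd : 2 ≤ d) {x : Fin d → ℝ} :
    x ∈ prismA d m hd ↔ x ∈ cornerBox d m ∧
      x ⟨0, by omega⟩ + 2 * x ⟨1, by omega⟩ ≤ 3 - 2 / (m : ℝ) := by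
  rw [mem_cornerBox_iff hd, prismA, Set.mem_ofPred_eq]
  have hpos : 0 < 1 / (m : ℝ) := by positivity
  rw [show 2 / (m : ℝ) = 2 * (1 / m) by ring]
  generalize 1 / (m : ℝ) = h at hpos ⊢
  generalize x ⟨0, by omega⟩ = u, x ⟨1, by omega⟩ = v
  rw [mem_convexHull_right_triangle (by linarith) (by linarith),
    show (u - (1 - 2 * h)) / (1 - (1 - 2 * h)) = (u - (1 - 2 * h)) / (2 * h) by ring,
    show (v - (1 - h)) / (1 - (1 - h)) = (v - (1 - h)) / h by ring,
    show (u - (1 - 2 * h)) / (2 * h) + (v - (1 - h)) / h = (u + 2 * v - (3 - 4 * h)) / (2 * h) by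
      field_simp
      ring,
    le_div_iff₀ (by positivity), le_div_iff₀ (by positivity), div_le_one (by positivity)]
  constructor
  · rintro ⟨⟨h0, h1, h2⟩, h3⟩
    exact ⟨⟨⟨by linarith, by linarith⟩, ⟨by linarith, by linarith⟩, h3⟩, by linarith⟩
  · rintro ⟨⟨⟨h0, -⟩, ⟨h1, -⟩, h3⟩, h2⟩
    exact ⟨⟨by linarith, by linarith, by linarith⟩, h3⟩

lemma mem_prismB_iff {m : ℕ} (hm : 2 ≤ m) (hd : 2 ≤ d) {x : Fin d → ℝ} :
    x ∈ prismB d m hd ↔ x ∈ cornerBox d m ∧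
      3 - 2 / (m : ℝ) ≤ x ⟨0, by omega⟩ + 2 * x ⟨1, by omega⟩ := by
  rw [mem_cornerBox_iff hd, prismB, Set.mem_ofPred_eq]
  have hpos : 0 < 1 / (m : ℝ) := by positivity
  rw [show 2 / (m : ℝ) = 2 * (1 / m) by ring]
  generalize 1 / (m : ℝ) = h at hpos ⊢
  generalize x ⟨0, by omega⟩ = u, x ⟨1, by omega⟩ = v
  rw [show ({![1, 1 - h], ![1 - 2 * h, 1], ![1, 1]} : Set (Fin 2 → ℝ)) =
      {![1, 1], ![1 - 2 * h, 1], ![1, 1 - h]} by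
      ext y
      simp only [Set.mem_insert_iff, Set.mem_singleton_iff]
      tauto,
    mem_convexHull_right_triangle (by linarith) (by linarith),
    show (u - 1) / (1 - 2 * h - 1) = (1 - u) / (2 * h) by
      rw [← neg_div_neg_eq]
      ring,
    show (v - 1) / (1 - h - 1) = (1 - v) / h by
      rw [← neg_div_neg_eq]
      ring,
    show (1 - u) / (2 * h) + (1 - v) / h = (3 - u - 2 * v) / (2 * h) by
      field_simp
      ring,
    le_div_iff₀ (by positivity), le_div_iff₀ (by positivity), div_le_one (by positivity)]
  constructor
  · rintro ⟨⟨h0, h1, h2⟩, h3⟩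
    exact ⟨⟨⟨by linarith, by linarith⟩, ⟨by linarith, by linarith⟩, h3⟩, by linarith⟩
  · rintro ⟨⟨⟨-, h0⟩, ⟨-, h1⟩, h3⟩, h2⟩
    exact ⟨⟨by linarith, by linarith, by linarith⟩, h3⟩

lemma prismA_union_prismB {m : ℕ} (hm : 2 ≤ m) (hd : 2 ≤ d) :
    prismA d m hd ∪ prismB d m hd = cornerBox d m := by
  ext x
  rw [Set.mem_union, mem_prismA_iff hm, mem_prismB_iff hm, ← and_or_left]
  exact and_iff_left (le_total _ _)

lemma volume_prismA_inter_prismB {m : ℕ} (hm : 2 ≤ m) (hd : 2 ≤ d) :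
    volume (prismA d m hd ∩ prismB d m hd) = 0 := by
  let L : (Fin d → ℝ) →ₗ[ℝ] ℝ :=
    LinearMap.proj ⟨0, by omega⟩ + (2 : ℝ) • LinearMap.proj ⟨1, by omega⟩
  have hL : L ≠ 0 := by
    intro h
    have := LinearMap.congr_fun h 1
    simp [L] at this
    norm_num at this
  refine measure_mono_null (fun x hx => ?_) (volume_linear_level_set hL (3 - 2 / (m : ℝ)))
  have h1 := ((mem_prismA_iff hm hd).1 hx.1).2
  have h2 := ((mem_prismB_iff hm hd).1 hx.2).2
  simpa [L] using le_antisymm h1 h2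

lemma vol_prismB_eq_vol_prismA {m : ℕ} (hm : 2 ≤ m) (hd : 2 ≤ d)
    (hmeas : MeasurableSet (prismA d m hd)) :
    vol (prismB d m hd) = vol (prismA d m hd) := by
  set a : Fin d → ℝ := fun k => if (k : ℕ) = 0 then 1 - 2 / (m : ℝ) else 1 - 1 / (m : ℝ)
    with ha
  have hpre : (fun x => (a + 1) - x) ⁻¹' prismA d m hd = prismB d m hd := by
    ext x
    rw [Set.mem_preimage, mem_prismA_iff hm, mem_prismB_iff hm]
    refine and_congr ?_ ?_
    · have : ((a + 1) - x ∈ Set.Icc a 1) ↔ x ∈ Set.Icc a 1 := by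
        simp only [Set.mem_Icc, Pi.le_def, ← forall_and]
        refine forall_congr' fun k => ?_
        simp only [Pi.sub_apply, Pi.add_apply, Pi.one_apply]
        constructor <;> rintro ⟨h1, h2⟩ <;> constructor <;> linarith
      exact this
    · simp only [Pi.sub_apply, Pi.add_apply, Pi.one_apply, ha]
      simp only [if_true, one_ne_zero, if_false]
      have hh : 2 / (m : ℝ) = 2 * (1 / m) := by ring
      rw [hh]
      constructor <;> intro h <;> linarith
  have h := (volume.measurePreserving_sub_left (a + 1)).measure_preimage hmeas.nullMeasurableSet
  rw [hpre] at h
  rw [vol, vol, h]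

end Geometry

/-- Reduction of the global comparison to a local one: if `Ωmod` is any partition of
`[0,1]^d` coinciding with the jittered partition outside `I = [1−2/m,1] × [1−1/m,1]^{d−1}`
and whose two sets inside `I` are the two triangular prisms, then
`m^{2d}·[E L2²(P_Ω) − E L2²(P_Ω̃)] = 4·|I|·[E L2²(P_{Ω_|}) − E L2²(P_{Ω_\})]`,
where the right-hand side involves the two-point stratified samples in the compact
convex set `K = I`, and `|I| = 2·m^{−d}`. -/
theorem global_sub_eq_local_sub (d m : ℕ) (hd : 2 ≤ d) (hm : 2 ≤ m)
    (Ωmod : (Fin d → Fin m) → Set (Fin d → ℝ))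
    (hpart : IsPartition (Set.Icc (0 : Fin d → ℝ) 1) Ωmod)
    (hA : Ωmod (idxA d m hm) = prismA d m hd)
    (hB : Ωmod (idxB d m hm) = prismB d m hd)
    (hrest : ∀ j, j ≠ idxA d m hm → j ≠ idxB d m hm → Ωmod j = jitteredCube m j) :
    (m : ℝ) ^ (2 * d) *
        (meanL2sq (Set.Icc (0 : Fin d → ℝ) 1) (jitteredCube m) -
          meanL2sq (Set.Icc (0 : Fin d → ℝ) 1) Ωmod) =
      4 * vol (cornerBox d m) *
        (meanL2sq (cornerBox d m)
            ![jitteredCube m (idxA d m hm), jitteredCube m (idxB d m hm)] -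
          meanL2sq (cornerBox d m) ![prismA d m hd, prismB d m hd]) ∧
      vol (cornerBox d m) = 2 / (m : ℝ) ^ d := by
  have hm0 : (0 : ℝ) < m := by positivity
  have hc0 : 0 < 1 / (m : ℝ) ^ d := by positivity
  have hAB := idxA_ne_idxB hm hd
  have hK : MeasurableSet (Set.Icc (0 : Fin d → ℝ) 1) := measurableSet_Icc
  have hKf : volume (Set.Icc (0 : Fin d → ℝ) 1) ≠ ⊤ := isCompact_Icc.measure_lt_top.ne
  have hKvol : vol (Set.Icc (0 : Fin d → ℝ) 1) = 1 := by
    rw [vol, Real.volume_Icc_pi_toReal zero_le_one]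
    simp
  have hI := measurableSet_cornerBox d m
  have hIf := volume_cornerBox_ne_top d m
  have hmeasA : MeasurableSet (prismA d m hd) := hA ▸ hpart.measurableSet _
  have hmeasB : MeasurableSet (prismB d m hd) := hB ▸ hpart.measurableSet _
  have hcube : ∀ {S : Set (Fin d → ℝ)}, MeasurableSet S →
      vol (jitteredCube m (idxA d m hm) ∩ S) + vol (jitteredCube m (idxB d m hm) ∩ S) =
        vol (cornerBox d m ∩ S) :=
    fun hS => vol_inter_add_vol_inter (measurableSet_jitteredCube _ _)
      (measurableSet_jitteredCube _ _) (volume_jitteredCube_inter hAB)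
      (jitteredCube_idxA_union_idxB hm hd) hIf hS
  have hprism : ∀ {S : Set (Fin d → ℝ)}, MeasurableSet S →
      vol (prismA d m hd ∩ S) + vol (prismB d m hd ∩ S) = vol (cornerBox d m ∩ S) :=
    fun hS => vol_inter_add_vol_inter hmeasA hmeasB (volume_prismA_inter_prismB hm hd)
      (prismA_union_prismB hm hd) hIf hS
  have hIvol : vol (cornerBox d m) = 2 / (m : ℝ) ^ d := by
    have h := hcube MeasurableSet.univ
    simp only [Set.inter_univ, vol_jitteredCube] at h
    rw [← h]
    ring
  have hBA := vol_prismB_eq_vol_prismA hm hd hmeasA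
  have hAvol : vol (prismA d m hd) = 1 / (m : ℝ) ^ d := by
    have h := hprism MeasurableSet.univ
    simp only [Set.inter_univ, hBA, hIvol] at h
    have : 2 / (m : ℝ) ^ d = 1 / (m : ℝ) ^ d + 1 / (m : ℝ) ^ d := by ring
    linarith
  have hBvol : vol (prismB d m hd) = 1 / (m : ℝ) ^ d := hBA.trans hAvol
  have hcard : (Fintype.card (Fin d → Fin m) : ℝ) = (m : ℝ) ^ d := by simp
  have hKcard : vol (Set.Icc (0 : Fin d → ℝ) 1) =
      Fintype.card (Fin d → Fin m) * (1 / (m : ℝ) ^ d) := by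
    rw [hKvol, hcard]
    field_simp
  have hIcard : vol (cornerBox d m) = Fintype.card (Fin 2) * (1 / (m : ℝ) ^ d) := by
    rw [hIvol]
    simp
    ring
  have hmod : ∀ j, vol (Ωmod j) = 1 / (m : ℝ) ^ d := by
    intro j
    by_cases h1 : j = idxA d m hm
    · rw [h1, hA, hAvol]
    by_cases h2 : j = idxB d m hm
    · rw [h2, hB, hBvol]
    rw [hrest j h1 h2, vol_jitteredCube]
  have hsumJ : ∀ x, ∑ j, vol (jitteredCube m j ∩ Set.Iic x) =
      vol (Set.Icc (0 : Fin d → ℝ) 1 ∩ Set.Iic x) := fun x =>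
    sum_vol_inter_eq (measurableSet_jitteredCube m) (fun i j h => volume_jitteredCube_inter h)
      (iUnion_jitteredCube (by omega)) hKf measurableSet_Iic
  have hsumM : ∀ x, ∑ j, vol (Ωmod j ∩ Set.Iic x) =
      vol (Set.Icc (0 : Fin d → ℝ) 1 ∩ Set.Iic x) := by
    intro x
    rw [← hsumJ, ← sub_eq_zero, ← Finset.sum_sub_distrib, Fintype.sum_eq_add _ _ hAB, hA, hB]
    · linarith [hcube (S := Set.Iic x) measurableSet_Iic,
        hprism (S := Set.Iic x) measurableSet_Iic]
    · rintro j ⟨h1, h2⟩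
      rw [hrest j h1 h2, sub_self]
  have hmeasM : ∀ j, MeasurableSet (Ωmod j) := hpart.measurableSet
  have hmeasJ2 : ∀ i, MeasurableSet
      (![jitteredCube m (idxA d m hm), jitteredCube m (idxB d m hm)] i) := by
    simp [Fin.forall_fin_two, measurableSet_jitteredCube]
  have hvolJ2 : ∀ i, vol (![jitteredCube m (idxA d m hm), jitteredCube m (idxB d m hm)] i) =
      1 / (m : ℝ) ^ d := by
    simp [Fin.forall_fin_two, vol_jitteredCube]
  have hmeasP : ∀ i, MeasurableSet (![prismA d m hd, prismB d m hd] i) := by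
    simp [Fin.forall_fin_two, hmeasA, hmeasB]
  have hvolP : ∀ i, vol (![prismA d m hd, prismB d m hd] i) = 1 / (m : ℝ) ^ d := by
    simp [Fin.forall_fin_two, hAvol, hBvol]
  have hfin : ∀ {s : Set (Fin d → ℝ)}, vol s = 1 / (m : ℝ) ^ d → volume s ≠ ⊤ := fun hs =>
    (ENNReal.toReal_pos_iff.1 (hs ▸ hc0 : 0 < vol _)).2.ne
  have hdiff : ∀ x, sumVar (jitteredCube m) x - sumVar Ωmod x =
      sumVar ![jitteredCube m (idxA d m hm), jitteredCube m (idxB d m hm)] x -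
        sumVar ![prismA d m hd, prismB d m hd] x := by
    intro x
    unfold sumVar qfun
    rw [← Finset.sum_sub_distrib, Fintype.sum_eq_add _ _ hAB, hA, hB]
    · simp only [Fin.sum_univ_two, Matrix.cons_val_zero, Matrix.cons_val_one]
      ring
    · rintro j ⟨h1, h2⟩
      rw [hrest j h1 h2, sub_self]
  have hJsub : ∀ i, ![jitteredCube m (idxA d m hm), jitteredCube m (idxB d m hm)] i ⊆
      cornerBox d m := by
    simp [Fin.forall_fin_two, ← jitteredCube_idxA_union_idxB hm hd]
  have hPsub : ∀ i, ![prismA d m hd, prismB d m hd] i ⊆ cornerBox d m := by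
    simp [Fin.forall_fin_two, ← prismA_union_prismB hm hd]
  have hIsub : cornerBox d m ⊆ Set.Icc (0 : Fin d → ℝ) 1 := by
    rw [← jitteredCube_idxA_union_idxB hm hd, ← iUnion_jitteredCube (by omega : 0 < m)]
    exact Set.union_subset (Set.subset_iUnion _ _) (Set.subset_iUnion _ _)
  have hint : ∫ x in Set.Icc (0 : Fin d → ℝ) 1,
      (sumVar (jitteredCube m) x - sumVar Ωmod x) = ∫ x in cornerBox d m,
      (sumVar ![jitteredCube m (idxA d m hm), jitteredCube m (idxB d m hm)] x -
        sumVar ![prismA d m hd, prismB d m hd] x) := by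
    simp only [hdiff]
    refine setIntegral_eq_of_subset_of_forall_sdiff_eq_zero hK hIsub fun x hx => ?_
    unfold sumVar
    rw [Finset.sum_eq_zero, Finset.sum_eq_zero, sub_zero]
    · intro i _
      rw [qfun_eq_zero_of_subset_Icc (hPsub i) hx.1.2 hx.2, zero_mul]
    · intro i _
      rw [qfun_eq_zero_of_subset_Icc (hJsub i) hx.1.2 hx.2, zero_mul]
  rw [integral_sub
      (integrableOn_sumVar hKf (measurableSet_jitteredCube m)
        fun j => hfin (vol_jitteredCube m j))
      (integrableOn_sumVar hKf hmeasM fun j => hfin (hmod j)),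
    integral_sub (integrableOn_sumVar hIf hmeasJ2 fun i => hfin (hvolJ2 i))
      (integrableOn_sumVar hIf hmeasP fun i => hfin (hvolP i))] at hint
  refine ⟨?_, hIvol⟩
  rw [meanL2sq_eq hK hKf (measurableSet_jitteredCube m)
      (fun j => by rw [vol_jitteredCube]; exact hc0)
      (fun x => sum_qfun_div_card (vol_jitteredCube m) hKcard (hsumJ x)),
    meanL2sq_eq hK hKf hmeasM (fun j => by rw [hmod]; exact hc0)
      (fun x => sum_qfun_div_card hmod hKcard (hsumM x)),
    meanL2sq_eq hI hIf hmeasJ2 (fun j => by rw [hvolJ2]; exact hc0)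
      (fun x => sum_qfun_div_card hvolJ2 hIcard
        (by simpa [Fin.sum_univ_two] using hcube measurableSet_Iic)),
    meanL2sq_eq hI hIf hmeasP (fun j => by rw [hvolP]; exact hc0)
      (fun x => sum_qfun_div_card hvolP hIcard
        (by simpa [Fin.sum_univ_two] using hprism measurableSet_Iic)),
    ← sub_div, ← sub_div, hint, hKvol, hcard, hIvol, Fintype.card_fin]
  field_simp
  ring

end StratifiedSampling
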